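/- Let w be a weight on ℝⁿ with [w]_{A∞} < ∞ and let f ∈ BMO. Then there exists a dimensional constant c_n, independent of f and w, such that for every cube Q and every p ≥ 1, ( (1/w(Q)) ∫_Q |f − f_Q|^p w dx )^{1/p} ≤ c_n · p · [w]_{A∞} · ‖f‖_{BMO}. -/

import Mathlib

open MeasureTheory ENNReal Set

noncomputable section

/-- The axis-parallel cube in `ℝⁿ` with lower corner `a` and side length `h`. -/
def Cube {n : ℕ} (a : Fin n → ℝ) (h : ℝ) : Set (Fin n → ℝ) :=
  Set.univ.pi fun i => Set.Icc (a i) (a i + h)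

/-- The concentric double `2Q` of the cube with lower corner `a` and side length `h`. -/
def Cube2 {n : ℕ} (a : Fin n → ℝ) (h : ℝ) : Set (Fin n → ℝ) :=
  Cube (fun i => a i - h / 2) (2 * h)

/-- The average `f_Q` of `f` over the cube with lower corner `a` and side length `h`. -/
def cubeAvg {n : ℕ} (a : Fin n → ℝ) (h : ℝ) (f : (Fin n → ℝ) → ℝ) : ℝ :=
  ⨍ x in Cube a h, f x

/-- The (uncentered) Hardy–Littlewood maximal function over axis-parallel cubes. -/
def maxFn {n : ℕ} (f : (Fin n → ℝ) → ℝ) (x : Fin n → ℝ) : ℝ≥0∞ :=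
  ⨆ (a : Fin n → ℝ) (h : ℝ) (_ : 0 < h) (_ : x ∈ Cube a h),
    (∫⁻ y in Cube a h, ENNReal.ofReal |f y|) / volume (Cube a h)

/-- The BMO seminorm `sup_Q (1/|Q|) ∫_Q |f - f_Q|`, valued in `ℝ≥0∞`. -/
def bmoNorm {n : ℕ} (f : (Fin n → ℝ) → ℝ) : ℝ≥0∞ :=
  ⨆ (a : Fin n → ℝ) (h : ℝ) (_ : 0 < h),
    (∫⁻ x in Cube a h, ENNReal.ofReal |f x - cubeAvg a h f|) / volume (Cube a h)

/-- The generalized weighted BMO norm `‖f‖_{BMO_{v,Y}} = sup_Q (1/Y(Q)) ∫_Q |f - f_Q| v`. -/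
def bmoVY {n : ℕ} (v : (Fin n → ℝ) → ℝ) (Y : (Fin n → ℝ) → ℝ → ℝ≥0∞)
    (f : (Fin n → ℝ) → ℝ) : ℝ≥0∞ :=
  ⨆ (a : Fin n → ℝ) (h : ℝ) (_ : 0 < h),
    (∫⁻ x in Cube a h, ENNReal.ofReal (|f x - cubeAvg a h f| * v x)) / Y a h

/-- `w(Q) = ∫_Q w` for a cube `Q`. -/
def wInt {n : ℕ} (w : (Fin n → ℝ) → ℝ) (a : Fin n → ℝ) (h : ℝ) : ℝ≥0∞ :=
  ∫⁻ x in Cube a h, ENNReal.ofReal (w x)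

/-- `w(2Q) = ∫_{2Q} w` for a cube `Q`. -/
def wInt2 {n : ℕ} (w : (Fin n → ℝ) → ℝ) (a : Fin n → ℝ) (h : ℝ) : ℝ≥0∞ :=
  ∫⁻ x in Cube2 a h, ENNReal.ofReal (w x)

/-- The generalized Fujii–Wilson constant `[v]_{A_{∞,Y}} = sup_Q (1/Y(Q)) ∫_Q M(v χ_Q)`. -/
def fwY {n : ℕ} (v : (Fin n → ℝ) → ℝ) (Y : (Fin n → ℝ) → ℝ → ℝ≥0∞) : ℝ≥0∞ :=
  ⨆ (a : Fin n → ℝ) (h : ℝ) (_ : 0 < h),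
    (∫⁻ x in Cube a h, maxFn ((Cube a h).indicator v) x) / Y a h

/-- The Fujii–Wilson `A∞` constant `[w]_{A∞} = sup_Q (1/w(Q)) ∫_Q M(w χ_Q)`. -/
def fwConst {n : ℕ} (w : (Fin n → ℝ) → ℝ) : ℝ≥0∞ :=
  ⨆ (a : Fin n → ℝ) (h : ℝ) (_ : 0 < h),
    (∫⁻ x in Cube a h, maxFn ((Cube a h).indicator w) x) / wInt w a h

/-- The weak Fujii–Wilson constant `[w]^{weak}_{A∞} = sup_Q (1/w(2Q)) ∫_Q M(w χ_Q)`. -/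
def fwWeak {n : ℕ} (w : (Fin n → ℝ) → ℝ) : ℝ≥0∞ :=
  ⨆ (a : Fin n → ℝ) (h : ℝ) (_ : 0 < h),
    (∫⁻ x in Cube a h, maxFn ((Cube a h).indicator w) x) / wInt2 w a h

/-- The `C_p` normalizing functional `Y(Q) = ∫_{ℝⁿ} M(χ_Q)^p w`. -/
def cpY {n : ℕ} (p : ℝ) (w : (Fin n → ℝ) → ℝ) (a : Fin n → ℝ) (h : ℝ) : ℝ≥0∞ :=
  ∫⁻ x, (maxFn ((Cube a h).indicator fun _ => (1 : ℝ)) x) ^ p * ENNReal.ofReal (w x)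

/-- The `C_p` Fujii–Wilson-type constant `[w]_{C_p}`. -/
def cpConst {n : ℕ} (p : ℝ) (w : (Fin n → ℝ) → ℝ) : ℝ≥0∞ :=
  ⨆ (a : Fin n → ℝ) (h : ℝ) (_ : 0 < h),
    (∫⁻ x in Cube a h, maxFn ((Cube a h).indicator w) x) / cpY p w a h

/-- The `A_p` constant `[w]_{A_p}` for `1 < p < ∞`. -/
def apConst {n : ℕ} (p : ℝ) (w : (Fin n → ℝ) → ℝ) : ℝ≥0∞ :=
  ⨆ (a : Fin n → ℝ) (h : ℝ) (_ : 0 < h),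
    (wInt w a h / volume (Cube a h)) *
      ((∫⁻ x in Cube a h, ENNReal.ofReal (w x) ^ (1 - p / (p - 1))) / volume (Cube a h)) ^ (p - 1)

/-- A weight: a nonnegative locally integrable function on `ℝⁿ`. -/
def IsWeight {n : ℕ} (v : (Fin n → ℝ) → ℝ) : Prop :=
  (∀ x, 0 ≤ v x) ∧ LocallyIntegrable v volume

/-- A cube functional `Y : 𝒬 → (0,∞)`: positive finite values on cubes. -/
def IsCubeFunctional {n : ℕ} (Y : (Fin n → ℝ) → ℝ → ℝ≥0∞) : Prop :=
  ∀ (a : Fin n → ℝ) (h : ℝ), 0 < h → 0 < Y a h ∧ Y a h < ⊤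

/-- Membership in the class `𝒴_q` with constant `β`: for every cube `Q`, every `L ≥ 1`
and every `L`-small family of pairwise non-overlapping subcubes of `Q`,
`∑_{P ∈ Λ} Y(P) ≤ β Y(Q) L^{-1/q}`. -/
def MemY {n : ℕ} (q β : ℝ) (Y : (Fin n → ℝ) → ℝ → ℝ≥0∞) : Prop :=
  ∀ (a : Fin n → ℝ) (h : ℝ), 0 < h → ∀ L : ℝ, 1 ≤ L →
    ∀ Λ : Set ((Fin n → ℝ) × ℝ),
      (∀ p ∈ Λ, 0 < p.2 ∧ Cube p.1 p.2 ⊆ Cube a h) →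
      (Λ.Pairwise fun p r => Disjoint (interior (Cube p.1 p.2)) (interior (Cube r.1 r.2))) →
      (∑' p : Λ, volume (Cube p.1.1 p.1.2)) ≤ volume (Cube a h) / ENNReal.ofReal L →
      (∑' p : Λ, Y p.1.1 p.1.2) ≤ ENNReal.ofReal β * Y a h * ENNReal.ofReal (L ^ (-1 / q))

/-- The Luxemburg norm in the Orlicz space `exp L^β` with respect to the measure `μ`. -/
def expLuxNorm {X : Type*} [MeasurableSpace X] (μ : Measure X) (β : ℝ) (g : X → ℝ) : ℝ≥0∞ :=
  ⨅ (lam : ℝ) (_ : 0 < lam)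
    (_ : ∫⁻ x, ENNReal.ofReal (Real.exp ((|g x| / lam) ^ β) - 1) ∂μ ≤ 1), ENNReal.ofReal lam

/-- The weighted measure `w dx` restricted to a set `Q`. -/
def wMeasureOn {n : ℕ} (w : (Fin n → ℝ) → ℝ) (Q : Set (Fin n → ℝ)) : Measure (Fin n → ℝ) :=
  (volume.restrict Q).withDensity fun x => ENNReal.ofReal (w x)

/-- The dyadic grid `𝒟(Q)` relative to the cube with lower corner `a₀` and side `h₀`:
parameters of all dyadic subcubes of `Q`. -/
def dyadicOf {n : ℕ} (a₀ : Fin n → ℝ) (h₀ : ℝ) : Set ((Fin n → ℝ) × ℝ) :=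
  {p | ∃ (k : ℕ) (m : Fin n → ℕ), (∀ i, m i < 2 ^ k) ∧
    p.2 = h₀ / 2 ^ k ∧ p.1 = fun i => a₀ i + (m i : ℝ) * (h₀ / 2 ^ k)}

/-- The functional `w_r(Q) = |Q| ((1/|Q|) ∫_Q w^r)^{1/r}`. -/
def wrY {n : ℕ} (w : (Fin n → ℝ) → ℝ) (r : ℝ) (a : Fin n → ℝ) (h : ℝ) : ℝ≥0∞ :=
  volume (Cube a h) *
    ((∫⁻ x in Cube a h, ENNReal.ofReal (w x) ^ r) / volume (Cube a h)) ^ (1 / r)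

section Descendants

variable {ι : Type*}

/-- The sum of `Φ` over the children `S Q` of `Q`. -/
def childSum (S : ι → Set ι) (Φ : ι → ℝ≥0∞) (Q : ι) : ℝ≥0∞ := ∑' P : S Q, Φ P

/-- The sum of `Φ` over all iterated children of `Q`, including `Q` itself. -/
def descSum (S : ι → Set ι) (Φ : ι → ℝ≥0∞) (Q : ι) : ℝ≥0∞ := ∑' k, (childSum S)^[k] Φ Q

lemma childSum_mono (S : ι → Set ι) : Monotone (childSum S) :=
  fun _ _ h _ => ENNReal.tsum_le_tsum fun P => h P

lemma descSum_mono (S : ι → Set ι) : Monotone (descSum S) :=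
  fun _ _ h Q => ENNReal.tsum_le_tsum fun k => (childSum_mono S).iterate k h Q

lemma childSum_const_mul (S : ι → Set ι) (c : ℝ≥0∞) (Φ : ι → ℝ≥0∞) :
    childSum S (fun Q => c * Φ Q) = fun Q => c * childSum S Φ Q := by
  funext Q
  simp [childSum, ENNReal.tsum_mul_left]

lemma descSum_const_mul (S : ι → Set ι) (c : ℝ≥0∞) (Φ : ι → ℝ≥0∞) :
    descSum S (fun Q => c * Φ Q) = fun Q => c * descSum S Φ Q := by
  have key : ∀ k, (childSum S)^[k] (fun Q => c * Φ Q) = fun Q => c * (childSum S)^[k] Φ Q := by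
    intro k
    induction k with
    | zero => rfl
    | succ k ih => simp only [Function.iterate_succ_apply', ih, childSum_const_mul]
  funext Q
  simp only [descSum, key, ENNReal.tsum_mul_left]

lemma descSum_eq (S : ι → Set ι) (Φ : ι → ℝ≥0∞) (Q : ι) :
    descSum S Φ Q = Φ Q + childSum S (descSum S Φ) Q := by
  simp only [descSum, childSum]
  rw [tsum_eq_zero_add' ENNReal.summable, ENNReal.tsum_comm]
  simp only [Function.iterate_succ_apply', Function.iterate_zero, id, childSum]

lemma iterate_descSum_le {S : ι → Set ι} {Φ : ι → ℝ≥0∞} {A : ℝ≥0∞}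
    (h : ∀ Q, descSum S Φ Q ≤ A * Φ Q) (m : ℕ) (Q : ι) :
    (descSum S)^[m] Φ Q ≤ A ^ m * Φ Q := by
  induction m generalizing Q with
  | zero => simp
  | succ m ih =>
    rw [Function.iterate_succ_apply']
    calc descSum S ((descSum S)^[m] Φ) Q
        ≤ descSum S (fun Q => A ^ m * Φ Q) Q := descSum_mono S ih Q
      _ = A ^ m * descSum S Φ Q := by rw [descSum_const_mul]
      _ ≤ A ^ m * (A * Φ Q) := by gcongr; exact h Q
      _ = A ^ (m + 1) * Φ Q := by ring

/-- If `Φ Q` plus the sum of `Ψ` over the children of `Q` is always at most `Ψ Q`, then the sum of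
`Φ` over all the descendants of `Q` is at most `Ψ Q`. -/
lemma descSum_le_of_childSum_le {S : ι → Set ι} {Φ Ψ : ι → ℝ≥0∞} (p : ι → Prop)
    (hp : ∀ Q, p Q → ∀ P ∈ S Q, p P) (h : ∀ Q, p Q → Φ Q + childSum S Ψ Q ≤ Ψ Q)
    (Q : ι) (hQ : p Q) : descSum S Φ Q ≤ Ψ Q := by
  have key : ∀ K Q, p Q → ∑ k ∈ Finset.range K, (childSum S)^[k] Φ Q ≤ Ψ Q := by
    intro K
    induction K with
    | zero => simp
    | succ K ih =>
      intro Q hQ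
      refine le_trans ?_ (h Q hQ)
      rw [Finset.sum_range_succ']
      simp only [Function.iterate_succ_apply', Function.iterate_zero, id, childSum]
      rw [add_comm]
      gcongr
      rw [← Summable.tsum_finsetSum fun _ _ => ENNReal.summable]
      exact ENNReal.tsum_le_tsum fun P => ih P (hp Q hQ P P.2)
  exact ENNReal.tsum_le_of_sum_range_le fun K => key K Q hQ

section Integral

variable [Countable ι] {X : Type*} [MeasurableSpace X]

lemma measurable_childSum (S : ι → Set ι) {Φ : X → ι → ℝ≥0∞}
    (h : ∀ Q, Measurable fun x => Φ x Q) (Q : ι) : Measurable fun x => childSum S (Φ x) Q :=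
  Measurable.tsum fun P => h P

lemma measurable_iterate_childSum (S : ι → Set ι) {Φ : X → ι → ℝ≥0∞}
    (h : ∀ Q, Measurable fun x => Φ x Q) (k : ℕ) (Q : ι) :
    Measurable fun x => (childSum S)^[k] (Φ x) Q := by
  induction k generalizing Q with
  | zero => exact h Q
  | succ k ih =>
    simp only [Function.iterate_succ_apply']
    exact measurable_childSum S ih Q

lemma lintegral_iterate_childSum (ν : Measure X) (S : ι → Set ι) {Φ : X → ι → ℝ≥0∞}
    (h : ∀ Q, Measurable fun x => Φ x Q) (k : ℕ) :
    (fun Q => ∫⁻ x, (childSum S)^[k] (Φ x) Q ∂ν)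
      = (childSum S)^[k] (fun Q => ∫⁻ x, Φ x Q ∂ν) := by
  induction k with
  | zero => rfl
  | succ k ih =>
    simp only [Function.iterate_succ_apply']
    rw [← ih]
    funext Q
    exact lintegral_tsum fun P => (measurable_iterate_childSum S h k P).aemeasurable

lemma measurable_descSum (S : ι → Set ι) {Φ : X → ι → ℝ≥0∞}
    (h : ∀ Q, Measurable fun x => Φ x Q) (Q : ι) : Measurable fun x => descSum S (Φ x) Q :=
  Measurable.tsum fun k => measurable_iterate_childSum S h k Q

lemma lintegral_descSum (ν : Measure X) (S : ι → Set ι) {Φ : X → ι → ℝ≥0∞}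
    (h : ∀ Q, Measurable fun x => Φ x Q) :
    (fun Q => ∫⁻ x, descSum S (Φ x) Q ∂ν) = descSum S (fun Q => ∫⁻ x, Φ x Q ∂ν) := by
  funext Q
  simp only [descSum]
  rw [lintegral_tsum fun k => (measurable_iterate_childSum S h k Q).aemeasurable]
  exact tsum_congr fun k => congrFun (lintegral_iterate_childSum ν S h k) Q

lemma measurable_iterate_descSum (S : ι → Set ι) {Φ : X → ι → ℝ≥0∞}
    (h : ∀ Q, Measurable fun x => Φ x Q) (m : ℕ) (Q : ι) :
    Measurable fun x => (descSum S)^[m] (Φ x) Q := by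
  induction m generalizing Q with
  | zero => exact h Q
  | succ m ih =>
    simp only [Function.iterate_succ_apply']
    exact measurable_descSum S ih Q

lemma lintegral_iterate_descSum (ν : Measure X) (S : ι → Set ι) {Φ : X → ι → ℝ≥0∞}
    (h : ∀ Q, Measurable fun x => Φ x Q) (m : ℕ) :
    (fun Q => ∫⁻ x, (descSum S)^[m] (Φ x) Q ∂ν)
      = (descSum S)^[m] (fun Q => ∫⁻ x, Φ x Q ∂ν) := by
  induction m with
  | zero => rfl
  | succ m ih =>
    simp only [Function.iterate_succ_apply']
    rw [← ih, lintegral_descSum ν S (measurable_iterate_descSum S h m)]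

end Integral

lemma multichoose_succ_le_iterate_descSum {S : ι → Set ι} {Φ : ι → ℝ≥0∞} {Q P : ι}
    (hP : P ∈ S Q) (hQ : 1 ≤ Φ Q) {j : ℕ}
    (h : ∀ m, (j.multichoose m : ℝ≥0∞) ≤ (descSum S)^[m] Φ P) (m : ℕ) :
    ((j + 1).multichoose m : ℝ≥0∞) ≤ (descSum S)^[m] Φ Q := by
  induction m with
  | zero => simpa using hQ
  | succ m ih =>
    rw [Nat.multichoose_succ_succ, Function.iterate_succ_apply', descSum_eq, add_comm, Nat.cast_add]
    refine add_le_add ih ((h (m + 1)).trans ?_)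
    rw [Function.iterate_succ_apply']
    exact ENNReal.le_tsum (f := fun P : S Q => descSum S ((descSum S)^[m] Φ) P) ⟨P, hP⟩

lemma one_le_iterate_descSum (S : ι → Set ι) {Φ : ι → ℝ≥0∞} {Q : ι} (hQ : 1 ≤ Φ Q) (m : ℕ) :
    1 ≤ (descSum S)^[m] Φ Q := by
  induction m with
  | zero => simpa using hQ
  | succ m ih =>
    rw [Function.iterate_succ_apply', descSum_eq]
    exact ih.trans le_self_add

lemma pow_le_factorial_mul_multichoose (j m : ℕ) : j ^ m ≤ m.factorial * j.multichoose m := by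
  rcases j with _ | j
  · rcases m with _ | m <;> simp
  · rw [Nat.multichoose_eq, show j + 1 + m - 1 = j + m by omega,
      ← Nat.ascFactorial_eq_factorial_mul_choose]
    exact Nat.pow_succ_le_ascFactorial _ _

/-- Pointwise domination along a chain of descendants: if `F Q ≤ d`, or `F Q ≤ d + F P` for some
child `P`, then `F Q ^ m` is controlled by the `m`-fold iterated sum over descendants. -/
lemma pow_le_iterate_descSum {S : ι → Set ι} {Φ : ι → ℝ≥0∞} {p : ι → Prop} {F : ι → ℝ} {d : ℝ}
    (hd : 0 < d) (hΦ : ∀ Q, p Q → 1 ≤ Φ Q)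
    (h : ∀ Q, p Q → F Q ≤ d ∨ ∃ P ∈ S Q, p P ∧ F Q ≤ d + F P)
    (m : ℕ) {Q : ι} (hQ : p Q) :
    ENNReal.ofReal (F Q) ^ m ≤ ENNReal.ofReal d ^ m * m.factorial * (descSum S)^[m] Φ Q := by
  have key : ∀ j : ℕ, ∀ Q, p Q →
      (∃ i : ℕ, F Q ≤ i * d ∧ ∀ m, (i.multichoose m : ℝ≥0∞) ≤ (descSum S)^[m] Φ Q) ∨
      ∀ m, (j.multichoose m : ℝ≥0∞) ≤ (descSum S)^[m] Φ Q := by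
    intro j
    induction j with
    | zero =>
      intro Q hQ
      right
      rintro (_ | m)
      · simpa using hΦ Q hQ
      · simp
    | succ j ih =>
      intro Q hQ
      rcases h Q hQ with h1 | ⟨P, hPS, hP, h1⟩
      · left
        refine ⟨1, by simpa using h1, fun m => ?_⟩
        simpa using one_le_iterate_descSum S (hΦ Q hQ) m
      · rcases ih P hP with ⟨i, hi, hi'⟩ | h2
        · left
          refine ⟨i + 1, ?_, multichoose_succ_le_iterate_descSum hPS (hΦ Q hQ) hi'⟩
          push_cast
          linarith
        · right
          exact multichoose_succ_le_iterate_descSum hPS (hΦ Q hQ) h2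
  have hpow : ∀ i : ℕ, F Q ≤ i * d → (∀ m, (i.multichoose m : ℝ≥0∞) ≤ (descSum S)^[m] Φ Q) →
      ENNReal.ofReal (F Q) ^ m ≤ ENNReal.ofReal d ^ m * m.factorial * (descSum S)^[m] Φ Q := by
    intro i hi hi'
    calc ENNReal.ofReal (F Q) ^ m ≤ ENNReal.ofReal (i * d) ^ m := by gcongr
      _ = ENNReal.ofReal d ^ m * ((i ^ m : ℕ) : ℝ≥0∞) := by
        rw [ENNReal.ofReal_mul (by positivity), mul_pow, mul_comm]; simp
      _ ≤ ENNReal.ofReal d ^ m * ((m.factorial * i.multichoose m : ℕ) : ℝ≥0∞) := by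
        gcongr
        exact pow_le_factorial_mul_multichoose i m
      _ ≤ _ := by
        push_cast
        rw [← mul_assoc]
        gcongr
        exact hi' m
  obtain ⟨j, hj⟩ := exists_nat_ge (F Q / d)
  rw [div_le_iff₀ hd] at hj
  rcases key j Q hQ with ⟨i, hi, hi'⟩ | h2
  · exact hpow i hi hi'
  · exact hpow j hj h2

end Descendants

section Stopping

variable {ι X : Type*} [Countable ι] [MeasurableSpace X] {μ ν : Measure X} {D : ι → Set X}
  {S : ι → Set ι}

/-- Carleson packing for a family of stopping sets: the Fujii–Wilson condition for the maximal
function `G Q` bounds the total `ν`-mass of all the descendants of `Q`. -/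
lemma descSum_measure_le (hD : ∀ Q, MeasurableSet (D Q)) (hμ : ∀ Q, μ (D Q) ≠ ⊤)
    (hμ0 : ∀ Q, μ (D Q) ≠ 0)
    (hsub : ∀ Q, ∀ P ∈ S Q, D P ⊆ D Q)
    (hdisj : ∀ Q, (S Q).PairwiseDisjoint D)
    (hhalf : ∀ Q, 2 * ∑' P : S Q, μ (D P) ≤ μ (D Q))
    {G : ι → X → ℝ≥0∞} (hG : ∀ Q, Measurable (G Q))
    (hGle : ∀ Q P, D P ⊆ D Q → ∀ x ∈ D P, ν (D P) / μ (D P) ≤ G Q x)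
    {A : ℝ≥0∞} (hA : ∀ Q, ∫⁻ x in D Q, G Q x ∂μ ≤ A * ν (D Q)) (Q : ι) :
    descSum S (fun P => ν (D P)) Q ≤ 2 * A * ν (D Q) := by
  refine (descSum_le_of_childSum_le (Ψ := fun P => 2 * ∫⁻ x in D P, G Q x ∂μ)
    (fun P => D P ⊆ D Q) (fun R hR P hP => (hsub R P hP).trans hR) ?_ Q Subset.rfl).trans ?_
  · intro R hR
    set U : Set X := ⋃ P : S R, D P with hU
    have hUm : MeasurableSet U := MeasurableSet.iUnion fun P => hD P
    have hUR : U ⊆ D R := iUnion_subset fun P => hsub R P P.2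
    have hdis : Pairwise (Function.onFun Disjoint fun P : S R => D P) := fun P P' hne =>
      hdisj R P.2 P'.2 (fun h => hne (Subtype.ext h))
    have hUμ : μ U = ∑' P : S R, μ (D P) := measure_iUnion hdis fun P => hD P
    have hsum : childSum S (fun P => 2 * ∫⁻ x in D P, G Q x ∂μ) R
        = 2 * ∫⁻ x in U, G Q x ∂μ := by
      rw [childSum_const_mul, hU, lintegral_iUnion (fun P : S R => hD P) hdis]
      rfl
    have hE : μ (D R) ≤ 2 * μ (D R \ U) := by
      have h1 : 2 * μ U ≤ μ (D R) := hUμ ▸ hhalf R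
      have h2 : μ (D R) = μ U + μ (D R \ U) := by
        rw [← measure_inter_add_sdiff (D R) hUm, inter_eq_self_of_subset_right hUR]
      have hUfin : μ U ≠ ⊤ := ((measure_mono hUR).trans_lt (hμ R).lt_top).ne
      have h3 : μ U ≤ μ (D R \ U) := by
        rw [h2, two_mul] at h1
        exact (ENNReal.add_le_add_iff_left hUfin).1 h1
      rw [h2, two_mul]
      gcongr
    have hν : ν (D R) ≤ 2 * ∫⁻ x in D R \ U, G Q x ∂μ := by
      calc ν (D R) = ν (D R) / μ (D R) * μ (D R) :=
            (ENNReal.div_mul_cancel (hμ0 R) (hμ R)).symm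
        _ ≤ ν (D R) / μ (D R) * (2 * μ (D R \ U)) := by gcongr
        _ = 2 * ∫⁻ x in D R \ U, ν (D R) / μ (D R) ∂μ := by
            rw [setLIntegral_const]; ring
        _ ≤ 2 * ∫⁻ x in D R \ U, G Q x ∂μ := by
            gcongr 2 * ?_
            exact setLIntegral_mono (hG Q) fun x hx => hGle Q R hR x hx.1
    rw [hsum]
    calc _ ≤ 2 * ∫⁻ x in D R \ U, G Q x ∂μ + 2 * ∫⁻ x in U, G Q x ∂μ := by gcongr
      _ = 2 * (∫⁻ x in D R ∩ U, G Q x ∂μ + ∫⁻ x in D R \ U, G Q x ∂μ) := by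
        rw [inter_eq_self_of_subset_right hUR]; ring
      _ = _ := by rw [lintegral_inter_add_sdiff _ _ hUm]
  · rw [mul_assoc]
    gcongr
    exact hA Q

/-- A moment estimate for a function with controlled oscillation along a stopping family. -/
lemma lintegral_pow_le (hD : ∀ Q, MeasurableSet (D Q)) {A : ℝ≥0∞}
    (hpack : ∀ Q, descSum S (fun P => ν (D P)) Q ≤ A * ν (D Q))
    {f : X → ℝ} {c : ι → ℝ} {d : ℝ} (hd : 0 < d)
    (hc : ∀ Q, ∀ P ∈ S Q, |c P - c Q| ≤ d)
    (hf : ∀ Q, ∀ᵐ x ∂ν, x ∈ D Q → (∀ P ∈ S Q, x ∉ D P) → |f x - c Q| ≤ d)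
    (m : ℕ) (Q : ι) :
    ∫⁻ x in D Q, ENNReal.ofReal |f x - c Q| ^ m ∂ν
      ≤ ENNReal.ofReal d ^ m * m.factorial * (A ^ m * ν (D Q)) := by
  set Φ : X → ι → ℝ≥0∞ := fun x P => (D P).indicator 1 x with hΦ
  have hΦm : ∀ P, Measurable fun x => Φ x P := fun P => measurable_one.indicator (hD P)
  have hfin : ENNReal.ofReal d ^ m * m.factorial ≠ ⊤ := by finiteness
  have hae : ∀ᵐ x ∂ν, x ∈ D Q → ENNReal.ofReal |f x - c Q| ^ m
      ≤ ENNReal.ofReal d ^ m * m.factorial * (descSum S)^[m] (Φ x) Q := by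
    filter_upwards [ae_all_iff.2 hf] with x hx hxQ
    refine pow_le_iterate_descSum (p := fun P => x ∈ D P) (F := fun P => |f x - c P|) hd
      (fun P hP => by simp [hΦ, hP]) (fun R hR => ?_) m hxQ
    by_cases h : ∀ P ∈ S R, x ∉ D P
    · exact Or.inl (hx R hR h)
    · push Not at h
      obtain ⟨P, hP, hxP⟩ := h
      refine Or.inr ⟨P, hP, hxP, ?_⟩
      have := abs_sub_le (f x) (c P) (c R)
      linarith [hc R P hP]
  calc ∫⁻ x in D Q, ENNReal.ofReal |f x - c Q| ^ m ∂ν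
      ≤ ∫⁻ x in D Q, ENNReal.ofReal d ^ m * m.factorial * (descSum S)^[m] (Φ x) Q ∂ν :=
        lintegral_mono_ae ((ae_restrict_iff' (hD Q)).2 hae)
    _ ≤ ∫⁻ x, ENNReal.ofReal d ^ m * m.factorial * (descSum S)^[m] (Φ x) Q ∂ν :=
        setLIntegral_le_lintegral _ _
    _ = ENNReal.ofReal d ^ m * m.factorial * (descSum S)^[m] (fun P => ν (D P)) Q := by
        rw [lintegral_const_mul' _ _ hfin]
        congr 1
        rw [congrFun (lintegral_iterate_descSum ν S hΦm m) Q]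
        simp [hΦ, lintegral_indicator_one (hD _)]
    _ ≤ _ := by
        gcongr
        exact iterate_descSum_le hpack m Q

end Stopping

section Dyadic

variable {n : ℕ}

/-- The side length of the dyadic cube with index `P`. -/
def dyadicSide (h : ℝ) (P : ℕ × (Fin n → ℤ)) : ℝ := h / 2 ^ P.1

/-- The lower corner of the dyadic cube with index `P`. -/
def dyadicCorner (a : Fin n → ℝ) (h : ℝ) (P : ℕ × (Fin n → ℤ)) : Fin n → ℝ :=
  fun i => a i + P.2 i * dyadicSide h P

/-- The half-open dyadic cube with index `P` in the grid generated by `Cube a h`. -/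
def dyadicCell (a : Fin n → ℝ) (h : ℝ) (P : ℕ × (Fin n → ℤ)) : Set (Fin n → ℝ) :=
  univ.pi fun i => Ico (dyadicCorner a h P i) (dyadicCorner a h P i + dyadicSide h P)

/-- The index of the dyadic cube of generation `k` containing `x`. -/
def dyadicIdx (a : Fin n → ℝ) (h : ℝ) (k : ℕ) (x : Fin n → ℝ) : ℕ × (Fin n → ℤ) :=
  (k, fun i => ⌊(x i - a i) / h * 2 ^ k⌋)

lemma dyadicSide_pos {h : ℝ} (hh : 0 < h) (P : ℕ × (Fin n → ℤ)) : 0 < dyadicSide h P := by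
  unfold dyadicSide; positivity

lemma dyadicCell_ae_eq (a : Fin n → ℝ) (h : ℝ) (P : ℕ × (Fin n → ℤ)) :
    dyadicCell a h P =ᵐ[volume] Cube (dyadicCorner a h P) (dyadicSide h P) := by
  rw [Cube, pi_univ_Icc]
  exact Measure.univ_pi_Ico_ae_eq_Icc

lemma dyadicCell_subset_cube (a : Fin n → ℝ) (h : ℝ) (P : ℕ × (Fin n → ℤ)) :
    dyadicCell a h P ⊆ Cube (dyadicCorner a h P) (dyadicSide h P) :=
  pi_mono fun _ _ => Ico_subset_Icc_self

lemma measurableSet_dyadicCell (a : Fin n → ℝ) (h : ℝ) (P : ℕ × (Fin n → ℤ)) :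
    MeasurableSet (dyadicCell a h P) :=
  MeasurableSet.univ_pi fun _ => measurableSet_Ico

lemma measurableSet_cube (a : Fin n → ℝ) (h : ℝ) : MeasurableSet (Cube a h) :=
  MeasurableSet.univ_pi fun _ => measurableSet_Icc

lemma isCompact_cube (a : Fin n → ℝ) (h : ℝ) : IsCompact (Cube a h) :=
  isCompact_univ_pi fun _ => isCompact_Icc

lemma volume_dyadicCell (a : Fin n → ℝ) (h : ℝ) (P : ℕ × (Fin n → ℤ)) :
    volume (dyadicCell a h P) = ENNReal.ofReal (dyadicSide h P) ^ n := by
  simp [dyadicCell, Real.volume_pi_Ico]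

lemma volume_dyadicCell_ne_zero (a : Fin n → ℝ) {h : ℝ} (hh : 0 < h) (P : ℕ × (Fin n → ℤ)) :
    volume (dyadicCell a h P) ≠ 0 := by
  rw [volume_dyadicCell]
  exact pow_ne_zero _ (by simpa using dyadicSide_pos hh P)

lemma volume_dyadicCell_ne_top (a : Fin n → ℝ) (h : ℝ) (P : ℕ × (Fin n → ℤ)) :
    volume (dyadicCell a h P) ≠ ⊤ := by
  rw [volume_dyadicCell]
  finiteness

lemma mem_dyadicCell_iff {a : Fin n → ℝ} {h : ℝ} (hh : 0 < h) {P : ℕ × (Fin n → ℤ)}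
    {x : Fin n → ℝ} : x ∈ dyadicCell a h P ↔ dyadicIdx a h P.1 x = P := by
  rcases P with ⟨k, l⟩
  have hk : (0 : ℝ) < 2 ^ k := by positivity
  simp only [dyadicCell, dyadicIdx, mem_univ_pi, Prod.mk.injEq, true_and, funext_iff,
    Int.floor_eq_iff, mem_Ico, dyadicCorner, dyadicSide]
  refine forall_congr' fun i => ?_
  rw [div_mul_eq_mul_div, le_div_iff₀ hh, div_lt_iff₀ hh, mul_div_assoc', add_assoc, ← add_div,
    ← le_sub_iff_add_le', ← sub_lt_iff_lt_add', div_le_iff₀ hk, lt_div_iff₀ hk]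
  constructor <;> rintro ⟨h1, h2⟩ <;> constructor <;> linarith

lemma mem_dyadicCell_idx (a : Fin n → ℝ) {h : ℝ} (hh : 0 < h) (k : ℕ) (x : Fin n → ℝ) :
    x ∈ dyadicCell a h (dyadicIdx a h k x) :=
  (mem_dyadicCell_iff hh).2 rfl

lemma dyadicIdx_succ (a : Fin n → ℝ) (h : ℝ) (k : ℕ) (x : Fin n → ℝ) (i : Fin n) :
    (dyadicIdx a h k x).2 i = (dyadicIdx a h (k + 1) x).2 i / 2 := by
  simp only [dyadicIdx]
  have := Int.floor_div_natCast ((x i - a i) / h * 2 ^ (k + 1)) 2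
  push_cast at this
  rw [← this]
  congr 1
  rw [pow_succ]
  ring

lemma dyadicIdx_eq_of_le {a : Fin n → ℝ} {h : ℝ} {k l : ℕ} (hkl : k ≤ l) {x y : Fin n → ℝ}
    (hxy : dyadicIdx a h l x = dyadicIdx a h l y) : dyadicIdx a h k x = dyadicIdx a h k y := by
  induction l, hkl using Nat.le_induction with
  | base => exact hxy
  | succ l _ ih =>
    refine ih (Prod.ext rfl (funext fun i => ?_))
    rw [dyadicIdx_succ a h l x, dyadicIdx_succ a h l y, hxy]

lemma dyadicCell_nonempty (a : Fin n → ℝ) {h : ℝ} (hh : 0 < h) (P : ℕ × (Fin n → ℤ)) :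
    (dyadicCell a h P).Nonempty :=
  nonempty_of_measure_ne_zero (volume_dyadicCell_ne_zero a hh P)

lemma dyadicCell_subset {a : Fin n → ℝ} {h : ℝ} (hh : 0 < h) {P Q : ℕ × (Fin n → ℤ)}
    (hPQ : Q.1 ≤ P.1) {z : Fin n → ℝ} (hzP : z ∈ dyadicCell a h P) (hzQ : z ∈ dyadicCell a h Q) :
    dyadicCell a h P ⊆ dyadicCell a h Q := by
  intro y hy
  rw [mem_dyadicCell_iff hh] at *
  rw [← hzQ]
  exact dyadicIdx_eq_of_le hPQ (hy.trans hzP.symm)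

lemma eq_of_mem_dyadicCell {a : Fin n → ℝ} {h : ℝ} (hh : 0 < h) {P Q : ℕ × (Fin n → ℤ)}
    (hPQ : P.1 = Q.1) {z : Fin n → ℝ} (hzP : z ∈ dyadicCell a h P) (hzQ : z ∈ dyadicCell a h Q) :
    P = Q := by
  rw [mem_dyadicCell_iff hh] at *
  rw [← hzP, ← hzQ, hPQ]

/-- The stopping family of `Q`: the maximal dyadic cubes strictly inside `Q` satisfying `bad`. -/
def stoppingFamily (a : Fin n → ℝ) (h : ℝ)
    (bad : ℕ × (Fin n → ℤ) → ℕ × (Fin n → ℤ) → Prop) (Q : ℕ × (Fin n → ℤ)) :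
    Set (ℕ × (Fin n → ℤ)) :=
  {P | Q.1 < P.1 ∧ dyadicCell a h P ⊆ dyadicCell a h Q ∧ bad Q P ∧
    ∀ R, Q.1 < R.1 → R.1 < P.1 → dyadicCell a h P ⊆ dyadicCell a h R → ¬ bad Q R}

lemma pairwiseDisjoint_stoppingFamily (a : Fin n → ℝ) {h : ℝ} (hh : 0 < h)
    (bad : ℕ × (Fin n → ℤ) → ℕ × (Fin n → ℤ) → Prop) (Q : ℕ × (Fin n → ℤ)) :
    (stoppingFamily a h bad Q).PairwiseDisjoint (dyadicCell a h) := by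
  intro P hP P' hP' hne
  refine Set.disjoint_left.2 fun z hz hz' => ?_
  rcases lt_trichotomy P.1 P'.1 with hlt | heq | hlt
  · exact hP'.2.2.2 P hP.1 hlt (dyadicCell_subset hh hlt.le hz' hz) hP.2.2.1
  · exact hne (eq_of_mem_dyadicCell hh heq hz hz')
  · exact hP.2.2.2 P' hP'.1 hlt (dyadicCell_subset hh hlt.le hz hz') hP'.2.2.1

lemma not_bad_of_forall_notMem {a : Fin n → ℝ} {h : ℝ} (hh : 0 < h)
    {bad : ℕ × (Fin n → ℤ) → ℕ × (Fin n → ℤ) → Prop} {Q : ℕ × (Fin n → ℤ)} {x : Fin n → ℝ}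
    (hxQ : x ∈ dyadicCell a h Q) (hx : ∀ P ∈ stoppingFamily a h bad Q, x ∉ dyadicCell a h P)
    {k : ℕ} (hk : Q.1 < k) : ¬ bad Q (dyadicIdx a h k x) := by
  induction k using Nat.strong_induction_on with
  | _ k ih =>
    intro hbad
    have hxk := mem_dyadicCell_idx a hh k x
    refine hx (dyadicIdx a h k x)
      ⟨hk, dyadicCell_subset hh hk.le hxk hxQ, hbad, fun R hQR hRk hsub => ?_⟩ hxk
    rw [← (mem_dyadicCell_iff hh).1 (hsub hxk)]
    exact ih R.1 hRk hQR

lemma exists_parent_of_mem_stoppingFamily {a : Fin n → ℝ} {h : ℝ} (hh : 0 < h)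
    {bad : ℕ × (Fin n → ℤ) → ℕ × (Fin n → ℤ) → Prop} {Q P : ℕ × (Fin n → ℤ)}
    (hP : P ∈ stoppingFamily a h bad Q) :
    ∃ R, dyadicCell a h P ⊆ dyadicCell a h R ∧ P.1 = R.1 + 1 ∧ (R = Q ∨ ¬ bad Q R) := by
  obtain ⟨z, hz⟩ := dyadicCell_nonempty a hh P
  have hQP := hP.1
  have hzR := mem_dyadicCell_idx a hh (P.1 - 1) z
  have hR1 : (dyadicIdx a h (P.1 - 1) z).1 = P.1 - 1 := rfl
  have hsub := dyadicCell_subset hh (by rw [hR1]; omega) hz hzR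
  refine ⟨_, hsub, by rw [hR1]; omega, ?_⟩
  rcases eq_or_lt_of_le (show Q.1 ≤ P.1 - 1 by omega) with heq | hlt
  · exact Or.inl (eq_of_mem_dyadicCell hh (by rw [hR1, heq]) hzR (hP.2.1 hz))
  · exact Or.inr (hP.2.2.2 _ hlt (by rw [hR1]; omega) hsub)

lemma volume_dyadicCell_of_eq_succ (a : Fin n → ℝ) {h : ℝ} {P R : ℕ × (Fin n → ℤ)}
    (hPR : P.1 = R.1 + 1) :
    volume (dyadicCell a h R) = 2 ^ n * volume (dyadicCell a h P) := by
  rw [volume_dyadicCell, volume_dyadicCell, ← mul_pow]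
  congr 1
  rw [show (2 : ℝ≥0∞) = ENNReal.ofReal 2 by simp, ← ENNReal.ofReal_mul (by norm_num)]
  congr 1
  simp only [dyadicSide, hPR, pow_succ]
  field_simp

/-- The Lebesgue differentiation theorem along the dyadic cubes shrinking to a point. -/
lemma ae_tendsto_setAverage_dyadicCell (a : Fin n → ℝ) {h : ℝ} (hh : 0 < h)
    {f : (Fin n → ℝ) → ℝ} (hf : LocallyIntegrable f volume) :
    ∀ᵐ x, Filter.Tendsto (fun k => ⨍ y in dyadicCell a h (dyadicIdx a h k x), f y)
      Filter.atTop (nhds (f x)) := by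
  filter_upwards [IsUnifLocDoublingMeasure.ae_tendsto_average volume hf 1] with x hx
  have hball : ∀ k, Metric.closedBall
      (fun i => dyadicCorner a h (dyadicIdx a h k x) i + h / 2 ^ k / 2) (h / 2 ^ k / 2)
      = Cube (dyadicCorner a h (dyadicIdx a h k x)) (dyadicSide h (dyadicIdx a h k x)) := by
    intro k
    rw [closedBall_pi _ (by positivity), Cube]
    congr 1
    funext i
    rw [Real.closedBall_eq_Icc]
    simp only [dyadicSide, dyadicIdx]
    congr 1 <;> ring
  have hlim : Filter.Tendsto (fun k : ℕ => h / 2 ^ k / 2) Filter.atTop (nhdsWithin 0 (Ioi 0)) := by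
    refine tendsto_nhdsWithin_iff.2 ⟨?_, Filter.Eventually.of_forall fun k => ?_⟩
    · have := (tendsto_pow_atTop_nhds_zero_of_lt_one (r := (1 / 2 : ℝ)) (by norm_num)
        (by norm_num)).const_mul (h / 2)
      rw [mul_zero] at this
      refine this.congr fun k => ?_
      rw [div_pow, one_pow]
      ring
    · exact mem_Ioi.2 (by positivity)
  have := hx (fun k i => dyadicCorner a h (dyadicIdx a h k x) i + h / 2 ^ k / 2)
    (fun k => h / 2 ^ k / 2) hlim (Filter.Eventually.of_forall fun k => by
      rw [one_mul, hball]
      exact dyadicCell_subset_cube a h _ (mem_dyadicCell_idx a hh k x))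
  refine this.congr fun k => ?_
  rw [hball]
  exact (setAverage_congr (dyadicCell_ae_eq a h _)).symm

end Dyadic

lemma ofReal_abs_setAverage_sub_le {X : Type*} [MeasurableSpace X] {μ : Measure X} {s : Set X}
    (h0 : μ s ≠ 0) (ht : μ s ≠ ⊤) {f : X → ℝ} (hf : IntegrableOn f s μ) (c : ℝ) :
    ENNReal.ofReal |(⨍ x in s, f x ∂μ) - c|
      ≤ (∫⁻ x in s, ENNReal.ofReal |f x - c| ∂μ) / μ s := by
  have hpos : 0 < μ.real s := ENNReal.toReal_pos h0 ht
  have h1 : (⨍ x in s, f x ∂μ) - c = (μ.real s)⁻¹ * ∫ x in s, (f x - c) ∂μ := by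
    rw [integral_sub hf (integrableOn_const ht), setIntegral_const, setAverage_eq, smul_eq_mul,
      smul_eq_mul]
    field_simp
  rw [h1, abs_mul, abs_of_pos (inv_pos.2 hpos), ENNReal.ofReal_mul (inv_pos.2 hpos).le,
    ENNReal.ofReal_inv_of_pos hpos, measureReal_def, ENNReal.ofReal_toReal ht, mul_comm,
    ← div_eq_mul_inv]
  gcongr
  simp only [← Real.enorm_eq_ofReal_abs]
  exact enorm_integral_le_lintegral_enorm _

/-- Moments with respect to a finite measure: passing from integer to real exponents. -/
lemma rpow_lintegral_div_le {X : Type*} [MeasurableSpace X] {ν : Measure X} (h0 : ν univ ≠ 0)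
    (ht : ν univ ≠ ⊤) {g : X → ℝ} (hg : AEStronglyMeasurable g ν) {K : ℝ≥0∞}
    (hK : ∀ m : ℕ, ∫⁻ x, ENNReal.ofReal |g x| ^ m ∂ν ≤ K ^ m * m.factorial * ν univ)
    {p : ℝ} (hp : 1 ≤ p) :
    ((∫⁻ x, ENNReal.ofReal |g x| ^ p ∂ν) / ν univ) ^ (1 / p) ≤ ENNReal.ofReal (2 * p) * K := by
  set ρ : Measure X := (ν univ)⁻¹ • ν with hρ
  have : IsProbabilityMeasure ρ := ⟨by simp [hρ, ENNReal.inv_mul_cancel h0 ht]⟩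
  have hp0 : 0 < p := by linarith
  set m : ℕ := ⌈p⌉₊ with hm
  have hpm : p ≤ m := Nat.le_ceil p
  have hm0 : (0 : ℝ) < m := hp0.trans_le hpm
  have hm2 : (m : ℝ) ≤ 2 * p := by
    have := Nat.ceil_lt_add_one hp0.le
    linarith
  have hgρ : AEStronglyMeasurable g ρ := hg.smul_measure _
  have hlp := eLpNorm'_le_eLpNorm'_of_exponent_le hp0 hpm ρ hgρ
  simp only [eLpNorm', hρ, lintegral_smul_measure, smul_eq_mul, Real.enorm_eq_ofReal_abs,
    ENNReal.rpow_natCast] at hlp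
  rw [div_eq_mul_inv, mul_comm]
  refine hlp.trans ?_
  calc ((ν univ)⁻¹ * ∫⁻ x, ENNReal.ofReal |g x| ^ m ∂ν) ^ (1 / (m : ℝ))
      ≤ ((K * m) ^ m) ^ (1 / (m : ℝ)) := by
        gcongr
        rw [mul_comm, ← div_eq_mul_inv]
        refine ENNReal.div_le_of_le_mul ((hK m).trans ?_)
        rw [mul_pow]
        gcongr
        exact_mod_cast Nat.factorial_le_pow m
    _ = K * m := by
        rw [one_div, ENNReal.pow_rpow_inv_natCast (by exact_mod_cast hm0.ne')]
    _ ≤ ENNReal.ofReal (2 * p) * K := by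
        rw [mul_comm, ← ENNReal.ofReal_natCast]
        gcongr

section Main

variable {n : ℕ}

lemma lintegral_oscillation_dyadicCell_le {f : (Fin n → ℝ) → ℝ} {B : ℝ≥0∞} (hB : bmoNorm f ≤ B)
    (a : Fin n → ℝ) {h : ℝ} (hh : 0 < h) (Q : ℕ × (Fin n → ℤ)) :
    ∫⁻ x in dyadicCell a h Q, ENNReal.ofReal |f x - ⨍ y in dyadicCell a h Q, f y|
      ≤ B * volume (dyadicCell a h Q) := by
  rw [setAverage_congr (dyadicCell_ae_eq a h Q), setLIntegral_congr (dyadicCell_ae_eq a h Q)]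
  refine (ENNReal.div_le_iff (volume_dyadicCell_ne_zero a hh Q)
    (volume_dyadicCell_ne_top a h Q)).1 ?_
  rw [measure_congr (dyadicCell_ae_eq a h Q)]
  refine le_trans ?_ hB
  exact le_iSup_of_le (dyadicCorner a h Q)
    (le_iSup₂_of_le (dyadicSide h Q) (dyadicSide_pos hh Q) le_rfl)

/-- The measure `w dx`. -/
def weightMeasure (w : (Fin n → ℝ) → ℝ) : Measure (Fin n → ℝ) :=
  volume.withDensity fun x => ENNReal.ofReal (w x)

lemma weightMeasure_apply (w : (Fin n → ℝ) → ℝ) {s : Set (Fin n → ℝ)} (hs : MeasurableSet s) :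
    weightMeasure w s = ∫⁻ x in s, ENNReal.ofReal (w x) :=
  withDensity_apply _ hs

lemma weightMeasure_absolutelyContinuous (w : (Fin n → ℝ) → ℝ) : weightMeasure w ≪ volume :=
  withDensity_absolutelyContinuous _ _

lemma weightMeasure_cube_ne_top {w : (Fin n → ℝ) → ℝ} (hw : IsWeight w) (a : Fin n → ℝ) (h : ℝ) :
    weightMeasure w (Cube a h) ≠ ⊤ := by
  rw [weightMeasure_apply w (measurableSet_cube a h)]
  have := (hw.2.integrableOn_isCompact (isCompact_cube a h)).2
  simp only [hasFiniteIntegral_iff_ofReal (Filter.Eventually.of_forall hw.1)] at this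
  exact this.ne

/-- The dyadic maximal function of `w` localized to the dyadic cube `Q`. -/
def dyadicMax (w : (Fin n → ℝ) → ℝ) (a : Fin n → ℝ) (h : ℝ) (Q : ℕ × (Fin n → ℤ))
    (x : Fin n → ℝ) : ℝ≥0∞ :=
  ⨆ (P : ℕ × (Fin n → ℤ)) (_ : dyadicCell a h P ⊆ dyadicCell a h Q),
    (dyadicCell a h P).indicator
      (fun _ => weightMeasure w (dyadicCell a h P) / volume (dyadicCell a h P)) x

lemma measurable_dyadicMax (w : (Fin n → ℝ) → ℝ) (a : Fin n → ℝ) (h : ℝ)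
    (Q : ℕ × (Fin n → ℤ)) : Measurable (dyadicMax w a h Q) :=
  Measurable.iSup fun P => Measurable.iSup fun _ =>
    measurable_const.indicator (measurableSet_dyadicCell a h P)

lemma dyadicMax_le_maxFn {w : (Fin n → ℝ) → ℝ} (hw : ∀ x, 0 ≤ w x) (a : Fin n → ℝ) {h : ℝ}
    (hh : 0 < h) (Q : ℕ × (Fin n → ℤ)) (x : Fin n → ℝ) :
    dyadicMax w a h Q x
      ≤ maxFn ((Cube (dyadicCorner a h Q) (dyadicSide h Q)).indicator w) x := by
  refine iSup₂_le fun P hPQ => indicator_le (fun x hx => ?_) x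
  refine le_iSup_of_le (dyadicCorner a h P) (le_iSup_of_le (dyadicSide h P)
    (le_iSup₂_of_le (dyadicSide_pos hh P) (dyadicCell_subset_cube a h P hx) ?_))
  rw [← measure_congr (dyadicCell_ae_eq a h P), ← setLIntegral_congr (dyadicCell_ae_eq a h P),
    weightMeasure_apply w (measurableSet_dyadicCell a h P)]
  refine ENNReal.div_le_div_right ?_ _
  refine (setLIntegral_congr_fun (measurableSet_dyadicCell a h P) fun y hy => ?_).le
  rw [indicator_of_mem (dyadicCell_subset_cube a h Q (hPQ hy)), abs_of_nonneg (hw y)]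

lemma lintegral_dyadicMax_le {w : (Fin n → ℝ) → ℝ} (hw : IsWeight w) (hA : fwConst w < ⊤)
    (a : Fin n → ℝ) {h : ℝ} (hh : 0 < h) (Q : ℕ × (Fin n → ℤ)) :
    ∫⁻ x in dyadicCell a h Q, dyadicMax w a h Q x
      ≤ fwConst w * weightMeasure w (dyadicCell a h Q) := by
  set C := Cube (dyadicCorner a h Q) (dyadicSide h Q) with hC
  have hν : weightMeasure w (dyadicCell a h Q) = weightMeasure w C :=
    measure_congr ((weightMeasure_absolutelyContinuous w).ae_eq (dyadicCell_ae_eq a h Q))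
  rw [hν]
  refine (ENNReal.div_le_iff_le_mul (Or.inr hA.ne)
    (Or.inl (weightMeasure_cube_ne_top hw _ _))).1 ?_
  rw [setLIntegral_congr (dyadicCell_ae_eq a h Q),
    weightMeasure_apply w (measurableSet_cube _ _)]
  refine le_trans ?_ (le_iSup_of_le (dyadicCorner a h Q)
    (le_iSup₂_of_le (dyadicSide h Q) (dyadicSide_pos hh Q) le_rfl))
  rw [wInt]
  gcongr with x
  exact dyadicMax_le_maxFn hw.1 a hh Q x

/-- The dyadic cube `P` is bad for `Q` if the mean oscillation over `P` about `f_Q` exceeds `2B`. -/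
def LargeOscillation (f : (Fin n → ℝ) → ℝ) (B : ℝ≥0∞) (a : Fin n → ℝ) (h : ℝ)
    (Q P : ℕ × (Fin n → ℤ)) : Prop :=
  2 * B * volume (dyadicCell a h P)
    < ∫⁻ x in dyadicCell a h P, ENNReal.ofReal |f x - ⨍ y in dyadicCell a h Q, f y|

lemma lintegral_pow_oscillation_le {w f : (Fin n → ℝ) → ℝ} (hw : IsWeight w)
    (hA : fwConst w < ⊤) (hf : LocallyIntegrable f volume) {B : ℝ} (hB0 : 0 < B)
    (hB : bmoNorm f ≤ ENNReal.ofReal B) (a : Fin n → ℝ) {h : ℝ} (hh : 0 < h)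
    (Q : ℕ × (Fin n → ℤ)) (m : ℕ) :
    ∫⁻ x in dyadicCell a h Q,
        ENNReal.ofReal |f x - ⨍ y in dyadicCell a h Q, f y| ^ m ∂(weightMeasure w)
      ≤ ENNReal.ofReal (2 ^ (n + 1) * B) ^ m * m.factorial *
        ((2 * fwConst w) ^ m * weightMeasure w (dyadicCell a h Q)) := by
  set c : ℕ × (Fin n → ℤ) → ℝ := fun Q => ⨍ y in dyadicCell a h Q, f y with hc
  set S := stoppingFamily a h (LargeOscillation f (ENNReal.ofReal B) a h) with hS
  have hosc := lintegral_oscillation_dyadicCell_le hB a hh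
  have hfint : ∀ P, IntegrableOn f (dyadicCell a h P) volume := fun P =>
    (hf.integrableOn_isCompact (isCompact_cube _ _)).mono_set (dyadicCell_subset_cube a h P)
  have hB1 : ENNReal.ofReal B ≠ 0 := by simpa using hB0
  have hcell : ∀ {K : ℝ} (P R : ℕ × (Fin n → ℤ)), 0 ≤ K →
      ∫⁻ x in dyadicCell a h P, ENNReal.ofReal |f x - c R|
        ≤ ENNReal.ofReal K * volume (dyadicCell a h P) → |c P - c R| ≤ K := by
    intro K P R hK hle
    have := (ofReal_abs_setAverage_sub_le (volume_dyadicCell_ne_zero a hh P)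
      (volume_dyadicCell_ne_top a h P) (hfint P) (c R)).trans (ENNReal.div_le_of_le_mul hle)
    exact (ENNReal.ofReal_le_ofReal_iff hK).1 this
  have h2B : 2 * ENNReal.ofReal B = ENNReal.ofReal (2 * B) := by
    rw [ENNReal.ofReal_mul (by norm_num)]; simp
  have hpow : (1 : ℝ) ≤ 2 ^ n := one_le_pow₀ (by norm_num)
  refine lintegral_pow_le (S := S) (c := c) (d := 2 ^ (n + 1) * B) (measurableSet_dyadicCell a h) ?_
    (by positivity) ?_ ?_ m Q
  · refine descSum_measure_le (measurableSet_dyadicCell a h) (volume_dyadicCell_ne_top a h)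
      (volume_dyadicCell_ne_zero a hh) (fun R P hP => hP.2.1)
      (pairwiseDisjoint_stoppingFamily a hh _) (fun R => ?_) (measurable_dyadicMax w a h)
      (fun R P hPR x hx => ?_) (lintegral_dyadicMax_le hw hA a hh)
    · have hdis : Pairwise (Function.onFun Disjoint fun P : S R => dyadicCell a h P) :=
        fun P P' hne => pairwiseDisjoint_stoppingFamily a hh _ R P.2 P'.2
          (fun h => hne (Subtype.ext h))
      have hsum : ENNReal.ofReal B * (2 * ∑' P : S R, volume (dyadicCell a h P))
          ≤ ENNReal.ofReal B * volume (dyadicCell a h R) := by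
        calc ENNReal.ofReal B * (2 * ∑' P : S R, volume (dyadicCell a h P))
            = ∑' P : S R, 2 * ENNReal.ofReal B * volume (dyadicCell a h P) := by
              rw [ENNReal.tsum_mul_left]; ring
          _ ≤ ∑' P : S R, ∫⁻ x in dyadicCell a h P, ENNReal.ofReal |f x - c R| :=
              ENNReal.tsum_le_tsum fun P => P.2.2.2.1.le
          _ = ∫⁻ x in ⋃ P : S R, dyadicCell a h P, ENNReal.ofReal |f x - c R| :=
              (lintegral_iUnion (fun P : S R => measurableSet_dyadicCell a h P) hdis _).symm
          _ ≤ ∫⁻ x in dyadicCell a h R, ENNReal.ofReal |f x - c R| :=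
              lintegral_mono_set (iUnion_subset fun P => P.2.2.1)
          _ ≤ _ := hosc R
      exact (ENNReal.mul_le_mul_iff_right hB1 ENNReal.ofReal_ne_top).1 hsum
    · refine le_iSup₂_of_le P hPR ?_
      rw [indicator_of_mem hx]
  · intro R P hP
    obtain ⟨T, hPT, hlevel, hT⟩ := exists_parent_of_mem_stoppingFamily hh hP
    refine hcell P R (by positivity) ?_
    have hTR : ∫⁻ x in dyadicCell a h T, ENNReal.ofReal |f x - c R|
        ≤ 2 * ENNReal.ofReal B * volume (dyadicCell a h T) := by
      rcases hT with rfl | hT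
      · refine (hosc T).trans ?_
        gcongr
        rw [two_mul]
        exact le_self_add
      · exact not_lt.1 hT
    refine (lintegral_mono_set hPT).trans (hTR.trans ?_)
    have hconst : ENNReal.ofReal (2 ^ (n + 1) * B) = 2 * ENNReal.ofReal B * 2 ^ n := by
      rw [ENNReal.ofReal_mul (by positivity), ENNReal.ofReal_pow (by norm_num),
        ENNReal.ofReal_ofNat]
      ring
    rw [volume_dyadicCell_of_eq_succ a hlevel, hconst, mul_assoc (2 * ENNReal.ofReal B)]
  · intro R
    refine (weightMeasure_absolutelyContinuous w).ae_le ?_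
    filter_upwards [ae_tendsto_setAverage_dyadicCell a hh hf] with x hx hxR hxS
    refine le_trans ?_ (show 2 * B ≤ 2 ^ (n + 1) * B by rw [pow_succ]; nlinarith)
    refine le_of_tendsto (hx.sub_const (c R)).abs ?_
    filter_upwards [Filter.eventually_gt_atTop R.1] with k hk
    refine hcell _ R (by positivity) ?_
    rw [← h2B]
    exact not_lt.1 (not_bad_of_forall_notMem hh hxR hxS hk)

lemma dyadicCell_zero_ae_eq (a : Fin n → ℝ) (h : ℝ) :
    dyadicCell a h (0, 0) =ᵐ[volume] Cube a h := by
  have hcorner : dyadicCorner a h ((0, 0) : ℕ × (Fin n → ℤ)) = a := by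
    funext i
    simp [dyadicCorner]
  have hside : dyadicSide h ((0, 0) : ℕ × (Fin n → ℤ)) = h := by simp [dyadicSide]
  simpa only [hcorner, hside] using dyadicCell_ae_eq a h (0, 0)

lemma lintegral_rpow_div_le {w f : (Fin n → ℝ) → ℝ} (hw : IsWeight w)
    (hA : fwConst w < ⊤) (hf : LocallyIntegrable f volume) {B : ℝ} (hB0 : 0 < B)
    (hB : bmoNorm f ≤ ENNReal.ofReal B) (a : Fin n → ℝ) {h : ℝ} (hh : 0 < h) {p : ℝ}
    (hp : 1 ≤ p) :
    ((∫⁻ x in Cube a h, ENNReal.ofReal (|f x - cubeAvg a h f| ^ p * w x)) / wInt w a h) ^ (1 / p)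
      ≤ ENNReal.ofReal (2 ^ (n + 3) * p) * fwConst w * ENNReal.ofReal B := by
  have hp0 : 0 < p := by linarith
  have hac := weightMeasure_absolutelyContinuous w
  have hcell := dyadicCell_zero_ae_eq a h
  set ν := (weightMeasure w).restrict (Cube a h) with hν
  have hνeq : ν = (volume.restrict (Cube a h)).withDensity fun x => ENNReal.ofReal (w x) :=
    restrict_withDensity (measurableSet_cube a h) _
  have hνu : ν univ = wInt w a h := by
    rw [hν, Measure.restrict_apply_univ, weightMeasure_apply w (measurableSet_cube a h), wInt]
  set g : (Fin n → ℝ) → ℝ := fun x => f x - cubeAvg a h f with hg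
  have hgm : AEStronglyMeasurable g volume :=
    hf.aestronglyMeasurable.sub aestronglyMeasurable_const
  have hnum : ∫⁻ x in Cube a h, ENNReal.ofReal (|f x - cubeAvg a h f| ^ p * w x)
      = ∫⁻ x, ENNReal.ofReal |g x| ^ p ∂ν := by
    rw [hνeq, lintegral_withDensity_eq_lintegral_mul₀
      hw.2.aestronglyMeasurable.aemeasurable.ennreal_ofReal.restrict
      (hgm.aemeasurable.abs.ennreal_ofReal.pow_const p).restrict]
    refine lintegral_congr fun x => ?_
    rw [Pi.mul_apply, ENNReal.ofReal_mul (by positivity), mul_comm,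
      ENNReal.ofReal_rpow_of_nonneg (abs_nonneg _) hp0.le]
  rw [hnum, ← hνu]
  by_cases h0 : ν univ = 0
  · rw [Measure.measure_univ_eq_zero.1 h0]
    simp [hp0]
  have ht : ν univ ≠ ⊤ := by
    rw [hν, Measure.restrict_apply_univ]
    exact weightMeasure_cube_ne_top hw a h
  refine (rpow_lintegral_div_le (K := ENNReal.ofReal (2 ^ (n + 1) * B) * (2 * fwConst w)) h0 ht
    (hgm.mono_ac (Measure.restrict_le_self.absolutelyContinuous.trans hac))
    (fun m => ?_) hp).trans_eq ?_
  · have := lintegral_pow_oscillation_le hw hA hf hB0 hB a hh (0, 0) m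
    rw [setAverage_congr hcell, Measure.restrict_congr_set (hac.ae_eq hcell),
      measure_congr (hac.ae_eq hcell)] at this
    refine this.trans_eq ?_
    rw [hν, Measure.restrict_apply_univ, mul_pow]
    ring
  · rw [show 2 * fwConst w = ENNReal.ofReal 2 * fwConst w by simp,
      ← mul_assoc, ← mul_assoc, ← ENNReal.ofReal_mul (by positivity),
      ← ENNReal.ofReal_mul (by positivity), mul_right_comm (ENNReal.ofReal (2 ^ (n + 3) * p)),
      ← ENNReal.ofReal_mul (by positivity)]
    congr 2
    ring

end Main

/-- for `w ∈ A∞` and `f ∈ BMO`, every cube `Q` and every `p ≥ 1`,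
`((1/w(Q)) ∫_Q |f - f_Q|^p w)^{1/p} ≤ c_n p [w]_{A∞} ‖f‖_BMO`. -/
theorem stmt7 (n : ℕ) :
    ∃ c : ℝ, 0 < c ∧
      ∀ (w f : (Fin n → ℝ) → ℝ), IsWeight w → fwConst w < ⊤ →
        LocallyIntegrable f volume → bmoNorm f < ⊤ →
        ∀ (a : Fin n → ℝ) (h : ℝ), 0 < h → ∀ p : ℝ, 1 ≤ p →
          ((∫⁻ x in Cube a h, ENNReal.ofReal (|f x - cubeAvg a h f| ^ p * w x)) /
              wInt w a h) ^ (1 / p)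
            ≤ ENNReal.ofReal (c * p) * fwConst w * bmoNorm f := by
  refine ⟨2 ^ (n + 3), by positivity, fun w f hw hA hf hB a h hh p hp => ?_⟩
  set K := ENNReal.ofReal (2 ^ (n + 3) * p) * fwConst w with hK
  have hKtop : K ≠ ⊤ := ENNReal.mul_ne_top ENNReal.ofReal_ne_top hA.ne
  have hlim : Filter.Tendsto (fun B => K * ENNReal.ofReal B)
      (nhdsWithin (bmoNorm f).toReal (Ioi (bmoNorm f).toReal)) (nhds (K * bmoNorm f)) := by
    refine ENNReal.Tendsto.const_mul ?_ (Or.inr hKtop)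
    have := ENNReal.continuous_ofReal.tendsto (bmoNorm f).toReal
    rw [ENNReal.ofReal_toReal hB.ne] at this
    exact this.mono_left nhdsWithin_le_nhds
  refine ge_of_tendsto hlim ?_
  filter_upwards [self_mem_nhdsWithin] with B hBgt
  exact lintegral_rpow_div_le hw hA hf (ENNReal.toReal_nonneg.trans_lt hBgt)
    ((ENNReal.ofReal_toReal hB.ne).symm.le.trans (ENNReal.ofReal_le_ofReal (le_of_lt hBgt))) a hh hp
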